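/- Let (x1, y1) ∈ X × Y be a data point and zi, zj ∈ Z two latent codes. Suppose d(x1, y1, zj) > 0 and d(x1, y1, zi) > C · d(x1, y1, zj) for some constant C > 1. Then there exist δx > 0 and δy > 0 such that for every (x2, y2) ∈ X × Y with ‖x1 − x2‖ < δx / K and ‖y1 − y2‖ < δy, one has d(x2, y2, zi) > d(x2, y2, zj). (Proposition 2: nearby data points have the same winning latent code.) -/

import Mathlib

theorem abs_norm_sub_sub_norm_sub_le {E : Type*} [SeminormedAddCommGroup E] (a b y y' : E) :
    |‖a - y‖ - ‖b - y'‖| ≤ ‖a - b‖ + ‖y - y'‖ := by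
  calc |‖a - y‖ - ‖b - y'‖| ≤ ‖(a - y) - (b - y')‖ := abs_norm_sub_norm_le _ _
    _ = ‖(a - b) - (y - y')‖ := by rw [sub_sub_sub_comm]
    _ ≤ ‖a - b‖ + ‖y - y'‖ := norm_sub_le _ _

/-- Proposition 2: nearby data points have the same winning latent code.
Here `d(x, y, z) = ‖f (x, z) - y‖`. -/
theorem prop2_same_winning_code
    {X Y Z : Type*} [NormedAddCommGroup X] [NormedSpace ℝ X]
    [NormedAddCommGroup Y] [NormedSpace ℝ Y]
    [NormedAddCommGroup Z] [NormedSpace ℝ Z]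
    (f : X × Z → Y) (K : ℝ) (hK : 0 < K)
    (hLip : ∀ (x1 x2 : X) (z : Z), ‖f (x1, z) - f (x2, z)‖ ≤ K * ‖x1 - x2‖)
    (x1 : X) (y1 : Y) (zi zj : Z) (C : ℝ) (hC : 1 < C)
    (hdj : 0 < ‖f (x1, zj) - y1‖)
    (hgap : ‖f (x1, zi) - y1‖ > C * ‖f (x1, zj) - y1‖) :
    ∃ δx δy : ℝ, 0 < δx ∧ 0 < δy ∧
      ∀ (x2 : X) (y2 : Y), ‖x1 - x2‖ < δx / K → ‖y1 - y2‖ < δy →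
        ‖f (x2, zi) - y2‖ > ‖f (x2, zj) - y2‖ := by
  have hpos : 0 < (‖f (x1, zi) - y1‖ - ‖f (x1, zj) - y1‖) / 4 := by
    have := mul_pos (sub_pos.2 hC) hdj
    linarith
  refine ⟨_, _, hpos, hpos, fun x2 y2 hx hy => ?_⟩
  have hKx := (lt_div_iff₀' hK).1 hx
  have hi := abs_le.1 (abs_norm_sub_sub_norm_sub_le (f (x1, zi)) (f (x2, zi)) y1 y2)
  have hj := abs_le.1 (abs_norm_sub_sub_norm_sub_le (f (x1, zj)) (f (x2, zj)) y1 y2)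
  linarith [hi.2, hj.1, hLip x1 x2 zi, hLip x1 x2 zj]
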